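/- Fix an integer n ≥ 1. For y > 0 and an integer k ≥ 0, let w_k(y) denote the k-th approximant of the continued fraction with partial numerators a₁ = 1 and a_j = ((j−1)·n)² for j ≥ 2, and partial denominators b_j = y − (2j−1)·n; explicitly, w_0 = 0 and w_k(y) = 1/(y−n − n²/(y−3n − (2n)²/(⋯ − ((k−1)n)²/(y−(2k−1)n)))). Then for every integer k ≥ 0, e^{−y/n}·(1/n)·li(e^{y/n}) − w_k(y) ∼ (n^k·k!)²/y^{2k+1} as y → ∞. -/

import Mathlib

open Filter

/-- The logarithmic integral, via the series
`li(x) = γ + log log x + ∑_{k=1}^∞ (log x)^k/(k·k!)` (valid for `x > 1`). -/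
noncomputable def li (x : ℝ) : ℝ :=
  Real.eulerMascheroniConstant + Real.log (Real.log x) +
    ∑' k : ℕ, (Real.log x) ^ (k + 1) / (((k : ℝ) + 1) * (Nat.factorial (k + 1) : ℝ))

/-- `cfApprox a b j k` is the `k`-th approximant of the continued fraction
`a_j/(b_j − a_{j+1}/(b_{j+1} − ⋯))`; the `0`-th approximant is `0`. -/
noncomputable def cfApprox (a b : ℕ → ℝ) : ℕ → ℕ → ℝ
  | _, 0 => 0
  | j, k + 1 => a j / (b j - cfApprox a b (j + 1) k)

open Asymptotics Topology

lemma hasDerivAt_tsum_pow_div_mul_factorial (x : ℝ) (hx : x ≠ 0) :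
    HasDerivAt (fun x : ℝ => ∑' k : ℕ, x ^ (k + 1) / (((k : ℝ) + 1) * (Nat.factorial (k + 1) : ℝ)))
      ((Real.exp x - 1) / x) x := by
  have hsum (r : ℝ) : Summable fun k : ℕ => r ^ k / (Nat.factorial (k + 1) : ℝ) := by
    refine .of_norm_bounded (Real.summable_pow_div_factorial |r|) fun k => ?_
    rw [norm_div, norm_pow, Real.norm_eq_abs, RCLike.norm_natCast]
    gcongr
    omega
  have hderiv : ∑' k : ℕ, x ^ k / (Nat.factorial (k + 1) : ℝ) = (Real.exp x - 1) / x := by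
    rw [Real.exp_eq_exp_ℝ, NormedSpace.exp_eq_tsum_div]
    simp only
    rw [(Real.summable_pow_div_factorial x).tsum_eq_zero_add, eq_div_iff hx, ← tsum_mul_right]
    simp only [pow_zero, Nat.factorial_zero, Nat.cast_one, div_one, add_sub_cancel_left]
    exact tsum_congr fun k => by ring
  rw [← hderiv]
  refine hasDerivAt_tsum_of_isPreconnected (t := Metric.ball 0 (|x| + 1)) (y₀ := 0)
    (g' := fun (k : ℕ) (y : ℝ) => y ^ k / (Nat.factorial (k + 1) : ℝ))
    (hsum (|x| + 1)) Metric.isOpen_ball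
    (convex_ball _ _).isPreconnected (fun k y _ => ?_) (fun k y hy => ?_) ?_ ?_ ?_
  · refine ((hasDerivAt_pow (k + 1) y).div_const _).congr_deriv ?_
    push_cast
    rw [mul_div_mul_left _ _ (by positivity)]
  · rw [norm_div, norm_pow, RCLike.norm_natCast]
    have := (mem_ball_zero_iff.mp hy).le
    gcongr
  · exact Metric.mem_ball_self (by positivity)
  · simp
  · simp

lemma hasDerivAt_li_exp (x : ℝ) (hx : x ≠ 0) :
    HasDerivAt (fun x => li (Real.exp x)) (Real.exp x / x) x := by
  simp only [li, Real.log_exp]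
  refine (((Real.hasDerivAt_log hx).const_add _).add
    (hasDerivAt_tsum_pow_div_mul_factorial x hx)).congr_deriv ?_
  field_simp
  ring

lemma hasDerivAt_exp_div_pow (M : ℕ) (x : ℝ) (hx : x ≠ 0) :
    HasDerivAt (fun x => Real.exp x / x ^ (M + 1))
      (Real.exp x / x ^ (M + 1) - (M + 1) * (Real.exp x / x ^ (M + 2))) x := by
  refine ((Real.hasDerivAt_exp x).div (hasDerivAt_pow (M + 1) x) (by positivity)).congr_deriv ?_
  push_cast
  field_simp
  ring

/-- The error, scaled by `exp x`, of the truncated expansion of `exp (-x) * li (exp x)`. -/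
noncomputable def liRemainder (M : ℕ) (x : ℝ) : ℝ :=
  li (Real.exp x) - ∑ m ∈ Finset.range M, (m.factorial : ℝ) * (Real.exp x / x ^ (m + 1))

lemma hasDerivAt_liRemainder (M : ℕ) (x : ℝ) (hx : x ≠ 0) :
    HasDerivAt (liRemainder M) (M.factorial * (Real.exp x / x ^ (M + 1))) x := by
  induction M with
  | zero =>
    unfold liRemainder
    simpa using hasDerivAt_li_exp x hx
  | succ M ih =>
    have h : liRemainder (M + 1) = fun x =>
        liRemainder M x - M.factorial * (Real.exp x / x ^ (M + 1)) := by
      ext x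
      simp only [liRemainder, Finset.sum_range_succ]
      ring
    rw [h]
    refine (ih.sub ((hasDerivAt_exp_div_pow M x hx).const_mul _)).congr_deriv ?_
    rw [Nat.factorial_succ]
    push_cast
    ring

lemma liRemainder_isBigO (M : ℕ) :
    liRemainder M =O[atTop] fun x => Real.exp x / x ^ (M + 1) := by
  set c : ℝ := 2 * (M + 1) with hc
  have hc0 : 0 < c := by positivity
  have hmono : MonotoneOn (liRemainder M) (Set.Ici c) := by
    refine monotoneOn_of_hasDerivWithinAt_nonneg (convex_Ici c)
      (f' := fun x => M.factorial * (Real.exp x / x ^ (M + 1))) ?_ ?_ ?_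
    · intro x hx
      exact (hasDerivAt_liRemainder M x
        (hc0.trans_le hx).ne').continuousAt.continuousWithinAt
    · intro x hx
      rw [interior_Ici] at hx
      exact (hasDerivAt_liRemainder M x (hc0.trans hx).ne').hasDerivWithinAt
    · intro x hx
      rw [interior_Ici] at hx
      have : 0 < x := hc0.trans hx
      positivity
  have hanti : AntitoneOn
      (fun x => liRemainder M x - 2 * M.factorial * (Real.exp x / x ^ (M + 1))) (Set.Ici c) := by
    have hd (x : ℝ) (hx : 0 < x) := (hasDerivAt_liRemainder M x hx.ne').sub
      ((hasDerivAt_exp_div_pow M x hx.ne').const_mul (2 * (M.factorial : ℝ)))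
    refine antitoneOn_of_hasDerivWithinAt_nonpos (convex_Ici c) ?_
      (fun x hx => (hd x ?_).hasDerivWithinAt) ?_
    · intro x hx
      exact (hd x (hc0.trans_le hx)).continuousAt.continuousWithinAt
    · rw [interior_Ici] at hx
      exact hc0.trans hx
    · intro x hx
      rw [interior_Ici] at hx
      have hx' : c < x := hx
      have hx0 : 0 < x := hc0.trans hx
      have : M.factorial * (Real.exp x / x ^ (M + 1)) - 2 * M.factorial *
          (Real.exp x / x ^ (M + 1) - (M + 1) * (Real.exp x / x ^ (M + 2))) =
          M.factorial * (Real.exp x / x ^ (M + 2)) * (c - x) := by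
        rw [hc]
        field_simp
        ring
      rw [this]
      exact mul_nonpos_of_nonneg_of_nonpos (by positivity) (by linarith)
  have hconst : (fun _ : ℝ => (1 : ℝ)) =O[atTop] fun x => Real.exp x / x ^ (M + 1) :=
    IsBigO.of_bound 1 <| by
      filter_upwards [(Real.tendsto_exp_div_pow_atTop (M + 1)).eventually_ge_atTop 1] with x hx
      rw [one_mul, norm_one]
      exact hx.trans (le_abs_self _)
  set K : ℝ := |liRemainder M c| +
    |liRemainder M c - 2 * M.factorial * (Real.exp c / c ^ (M + 1))|
  have hbound : liRemainder M =O[atTop]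
      fun x => K * 1 + 2 * M.factorial * (Real.exp x / x ^ (M + 1)) := by
    refine IsBigO.of_bound 1 ?_
    filter_upwards [eventually_ge_atTop c] with x hx
    have hx0 : 0 < x := hc0.trans_le hx
    have h1 := hmono (Set.mem_Ici.mpr le_rfl) (Set.mem_Ici.mpr hx) hx
    have h2 := hanti (Set.mem_Ici.mpr le_rfl) (Set.mem_Ici.mpr hx) hx
    simp only at h2
    have h3 : 0 ≤ 2 * M.factorial * (Real.exp x / x ^ (M + 1)) := by positivity
    rw [one_mul, Real.norm_eq_abs]
    refine le_trans (abs_le.mpr ⟨?_, ?_⟩) (le_abs_self _)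
    · have := neg_abs_le (liRemainder M c)
      have := abs_nonneg (liRemainder M c - 2 * M.factorial * (Real.exp c / c ^ (M + 1)))
      linarith
    · have := abs_nonneg (liRemainder M c)
      have := le_abs_self (liRemainder M c - 2 * M.factorial * (Real.exp c / c ^ (M + 1)))
      linarith
  exact hbound.trans ((hconst.const_mul_left K).add ((isBigO_refl _ _).const_mul_left _))

/-- `f` has the asymptotic expansion `∑ c m / y ^ (m + 1)` at infinity. -/
def HasInvExpansion (f : ℝ → ℝ) (c : ℕ → ℝ) : Prop :=
  ∀ M : ℕ, (fun y => f y - ∑ m ∈ Finset.range M, c m / y ^ (m + 1)) =O[atTop]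
    fun y => (y ^ (M + 1))⁻¹

namespace HasInvExpansion

variable {f g : ℝ → ℝ} {c d : ℕ → ℝ}

lemma sub (hf : HasInvExpansion f c) (hg : HasInvExpansion g d) :
    HasInvExpansion (fun y => f y - g y) (fun m => c m - d m) := fun M => by
  refine ((hf M).sub (hg M)).congr_left fun y => ?_
  simp only [sub_div, Finset.sum_sub_distrib]
  ring

lemma const_mul (a : ℝ) (hf : HasInvExpansion f c) :
    HasInvExpansion (fun y => a * f y) (fun m => a * c m) := fun M => by
  refine ((hf M).const_mul_left a).congr_left fun y => ?_
  simp only [mul_sub, Finset.mul_sum, mul_div_assoc]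

lemma id_mul_sub (hf : HasInvExpansion f c) :
    HasInvExpansion (fun y => y * f y - c 0) (fun m => c (m + 1)) := fun M => by
  refine ((isBigO_refl (fun y : ℝ => y) atTop).mul (hf (M + 1))).congr' ?_ ?_
  · filter_upwards [eventually_ne_atTop 0] with y hy
    rw [Finset.sum_range_succ', mul_sub, mul_add, Finset.mul_sum]
    have : ∀ m, y * (c (m + 1) / y ^ (m + 1 + 1)) = c (m + 1) / y ^ (m + 1) := fun m => by
      field_simp
      ring
    simp only [this]
    field_simp
    ring
  · filter_upwards [eventually_ne_atTop 0] with y hy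
    field_simp
    ring

lemma tendsto_mul_pow (hf : HasInvExpansion f c) (k : ℕ) (hc : ∀ m < k, c m = 0) :
    Tendsto (fun y => f y * y ^ (k + 1)) atTop (𝓝 (c k)) := by
  have h := (hf (k + 1)).mul (isBigO_refl (fun y : ℝ => y ^ (k + 1)) atTop)
  have h0 : Tendsto (fun y : ℝ => (y ^ (k + 1 + 1))⁻¹ * y ^ (k + 1)) atTop (𝓝 0) := by
    refine tendsto_inv_atTop_zero.congr' ?_
    filter_upwards [eventually_ne_atTop 0] with y hy
    field_simp
    ring
  have h1 := (h.trans_tendsto h0).add_const (c k)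
  rw [zero_add] at h1
  refine h1.congr' ?_
  filter_upwards [eventually_ne_atTop 0] with y hy
  rw [Finset.sum_range_succ,
    Finset.sum_eq_zero fun m hm => by rw [hc m (Finset.mem_range.mp hm), zero_div]]
  field_simp
  ring

end HasInvExpansion

lemma hasInvExpansion_li_exp (n : ℕ) (hn : 1 ≤ n) :
    HasInvExpansion (fun y => Real.exp (-(y / n)) * ((1 / (n : ℝ)) * li (Real.exp (y / n))))
      (fun m => (n : ℝ) ^ m * m.factorial) := fun M => by
  have hn0 : (0 : ℝ) < n := by exact_mod_cast hn
  have h := (((isBigO_refl (fun x => Real.exp (-x)) atTop).mul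
    (liRemainder_isBigO M)).comp_tendsto
      (tendsto_id.atTop_div_const hn0)).const_mul_left (1 / (n : ℝ))
  have h' := h.trans (k := fun y : ℝ => (y ^ (M + 1))⁻¹) ?_
  · refine h'.congr' ?_ .rfl
    filter_upwards [eventually_ne_atTop 0] with y hy
    simp only [Function.comp, id, liRemainder]
    rw [mul_sub, mul_sub, Finset.mul_sum, Finset.mul_sum]
    congr 1
    · ring
    · refine Finset.sum_congr rfl fun m _ => ?_
      rw [Real.exp_neg, div_pow]
      have := Real.exp_ne_zero (y / n)
      field_simp
      ring
  · refine ((isBigO_refl (fun y : ℝ => (y ^ (M + 1))⁻¹) atTop).const_mul_left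
      ((n : ℝ) ^ (M + 1))).congr' ?_ .rfl
    filter_upwards [eventually_ne_atTop 0] with y hy
    simp only [Function.comp, id, Real.exp_neg, div_pow]
    have := Real.exp_ne_zero (y / n)
    field_simp

/-- The solution of the three-term recurrence of a continued fraction whose value is `f`
(at the first index) and whose tails are the quotients of consecutive terms. -/
def cfResidual (a b : ℕ → ℝ) (f : ℝ) : ℕ → ℝ
  | 0 => 1
  | 1 => f
  | k + 2 => b (k + 1) * cfResidual a b f (k + 1) - a (k + 1) * cfResidual a b f k

/-- If the tails `t j` of a continued fraction satisfy `t j ∼ a j / y`, then its approximants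
satisfy the expected error asymptotics. -/
lemma tendsto_sub_cfApprox (a : ℕ → ℝ) (b t : ℕ → ℝ → ℝ)
    (hb : ∀ j, Tendsto (fun y => b j y / y) atTop (𝓝 1))
    (ht : ∀ j, Tendsto (fun y => t j y * y) atTop (𝓝 (a (j + 1))))
    (hrec : ∀ j, ∀ᶠ y in atTop, t j y = a (j + 1) / (b (j + 1) y - t (j + 1) y)) (k j : ℕ) :
    Tendsto (fun y => (t j y - cfApprox a (fun i => b i y) (j + 1) k) * y ^ (2 * k + 1)) atTop
      (𝓝 (∏ i ∈ Finset.range (k + 1), a (j + 1 + i))) := by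
  induction k generalizing j with
  | zero => simpa [cfApprox] using ht j
  | succ k ih =>
    have hinv : Tendsto (fun y : ℝ => y⁻¹) atTop (𝓝 0) := tendsto_inv_atTop_zero
    have ht0 : Tendsto (fun y => t (j + 1) y / y) atTop (𝓝 0) := by
      have h := (ht (j + 1)).mul (hinv.pow 2)
      rw [zero_pow two_ne_zero, mul_zero] at h
      refine h.congr' ?_
      filter_upwards [eventually_ne_atTop 0] with y hy
      field_simp
    have he0 : Tendsto (fun y => (t (j + 1) y - cfApprox a (fun i => b i y) (j + 1 + 1) k) / y)
        atTop (𝓝 0) := by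
      have h := (ih (j + 1)).mul (hinv.pow (2 * k + 2))
      rw [zero_pow (by omega), mul_zero] at h
      refine h.congr' ?_
      filter_upwards [eventually_ne_atTop 0] with y hy
      rw [inv_pow]
      field_simp
      ring
    have hd1 : Tendsto (fun y => (b (j + 1) y - t (j + 1) y) / y) atTop (𝓝 1) := by
      simpa only [sub_zero, sub_div] using (hb (j + 1)).sub ht0
    have hd2 : Tendsto (fun y => (b (j + 1) y - cfApprox a (fun i => b i y) (j + 1 + 1) k) / y)
        atTop (𝓝 1) := by
      have h := hd1.add he0
      rw [add_zero] at h
      exact h.congr fun y => by ring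
    have h := ((ih (j + 1)).const_mul (a (j + 1))).div (hd1.mul hd2) (by norm_num)
    rw [mul_one, div_one] at h
    have hprod : ∏ i ∈ Finset.range (k + 1 + 1), a (j + 1 + i) =
        a (j + 1) * ∏ i ∈ Finset.range (k + 1), a (j + 1 + 1 + i) := by
      rw [Finset.prod_range_succ', mul_comm, add_zero]
      exact congrArg _ (Finset.prod_congr rfl fun i _ => by rw [add_assoc (j + 1), add_comm 1])
    rw [hprod]
    refine h.congr' ?_
    filter_upwards [eventually_ne_atTop 0, hrec j, hd1.eventually_ne one_ne_zero,
      hd2.eventually_ne one_ne_zero] with y hy hr h1 h2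
    rw [cfApprox, hr]
    have h1' := (div_ne_zero_iff.mp h1).1
    have h2' := (div_ne_zero_iff.mp h2).1
    simp only [Pi.div_apply]
    field_simp
    ring

lemma hasInvExpansion_cfResidual (n : ℕ) (f : ℝ → ℝ)
    (hf : HasInvExpansion f fun m => (n : ℝ) ^ m * m.factorial) (k : ℕ) :
    HasInvExpansion (fun y => cfResidual (fun j => if j = 1 then 1 else (((j - 1) * n : ℕ) : ℝ) ^ 2)
        (fun j => y - ((2 * j - 1 : ℕ) : ℝ) * n) (f y) (k + 1))
      (fun m => (n : ℝ) ^ (m + k) * m.factorial * m.descFactorial k) := by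
  induction k using Nat.twoStepInduction with
  | zero => simpa [cfResidual] using hf
  | one =>
    convert hf.id_mul_sub.sub (hf.const_mul n) using 2 with y m
    · simp [cfResidual]
      ring
    · simp [Nat.factorial_succ]
      ring
  | more k h0 h1 =>
    convert (h1.id_mul_sub.sub (h1.const_mul ((2 * k + 3) * n))).sub
      (h0.const_mul (((k + 1) * n) ^ 2)) using 2 with y m
    · rw [cfResidual]
      have : 2 * (k + 1 + 1) - 1 = 2 * k + 3 := by omega
      simp [this]
      ring
    · have hs (i : ℕ) : ((m.descFactorial (i + 1) : ℕ) : ℝ) = (m - i) * m.descFactorial i := by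
        rcases le_or_gt i m with h | h
        · rw [Nat.descFactorial_succ, Nat.cast_mul, Nat.cast_sub h]
        · simp [Nat.descFactorial_of_lt h]
      rw [hs, hs, Nat.succ_descFactorial_succ, Nat.factorial_succ]
      push_cast
      ring


/-- Fix `n ≥ 1`, and let `w_k(y)` be the `k`-th approximant of the continued fraction with
partial numerators `a₁ = 1`, `a_j = ((j−1)n)²` for `j ≥ 2`, and partial denominators
`b_j = y − (2j−1)n`.  Then for every `k ≥ 0`,
`e^{−y/n}·(1/n)·li(e^{y/n}) − w_k(y) ∼ (n^k·k!)²/y^{2k+1}` as `y → ∞`. -/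
theorem li_cf_approximant_asymptotics (n : ℕ) (hn : 1 ≤ n) (k : ℕ) :
    Tendsto (fun y : ℝ =>
        (Real.exp (-(y / n)) * ((1 / (n : ℝ)) * li (Real.exp (y / n)))
          - cfApprox (fun j => if j = 1 then 1 else (((j - 1) * n : ℕ) : ℝ) ^ 2)
              (fun j => y - ((2 * j - 1 : ℕ) : ℝ) * n) 1 k)
        / (((n : ℝ) ^ k * (Nat.factorial k : ℝ)) ^ 2 / y ^ (2 * k + 1)))
      atTop (nhds 1) := by
  have hn0 : (0 : ℝ) < n := by exact_mod_cast hn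
  set a : ℕ → ℝ := fun j => if j = 1 then 1 else (((j - 1) * n : ℕ) : ℝ) ^ 2 with ha
  have ha' (j : ℕ) : a (j + 2) = ((j + 1) * n) ^ 2 := by simp [ha]
  set f : ℝ → ℝ := fun y => Real.exp (-(y / n)) * ((1 / (n : ℝ)) * li (Real.exp (y / n)))
  set b : ℕ → ℝ → ℝ := fun j y => y - ((2 * j - 1 : ℕ) : ℝ) * n with hb
  set r : ℕ → ℝ → ℝ := fun j y => cfResidual a (fun i => b i y) (f y) j with hr
  have hlim (j : ℕ) : Tendsto (fun y => r j y * y ^ j) atTop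
      (𝓝 (∏ i ∈ Finset.range j, a (i + 1))) := by
    cases j with
    | zero => simp [hr, cfResidual]
    | succ j =>
      convert (hasInvExpansion_cfResidual n f
        (hasInvExpansion_li_exp n hn) j).tendsto_mul_pow j ?_ using 2
      · rw [Nat.descFactorial_self]
        induction j with
        | zero => simp [ha]
        | succ j ih =>
          rw [Finset.prod_range_succ, ih, ha', Nat.factorial_succ]
          push_cast
          ring
      · intro m hm
        simp [Nat.descFactorial_of_lt hm]
  have hpos (j : ℕ) : 0 < ∏ i ∈ Finset.range j, a (i + 1) := by
    refine Finset.prod_pos fun i _ => ?_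
    cases i with
    | zero => simp [ha]
    | succ i =>
      rw [ha']
      positivity
  have hne (j : ℕ) : ∀ᶠ y in atTop, r j y ≠ 0 := by
    filter_upwards [(hlim j).eventually_ne (hpos j).ne'] with y hy
    exact left_ne_zero_of_mul hy
  have key := tendsto_sub_cfApprox a b (fun j y => r (j + 1) y / r j y) (fun j => ?_)
    (fun j => ?_) (fun j => ?_) k 0
  · have hc (k : ℕ) : ∏ i ∈ Finset.range (k + 1), a (0 + 1 + i) =
        ((n : ℝ) ^ k * (Nat.factorial k : ℝ)) ^ 2 := by
      induction k with
      | zero => simp [ha]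
      | succ k ih =>
        rw [Finset.prod_range_succ, ih, show 0 + 1 + (k + 1) = k + 2 by ring, ha',
          Nat.factorial_succ]
        push_cast
        ring
    rw [hc] at key
    have h := key.div_const (((n : ℝ) ^ k * (Nat.factorial k : ℝ)) ^ 2)
    rw [div_self (by positivity)] at h
    refine h.congr fun y => ?_
    simp only [hr, cfResidual, div_one, zero_add]
    rw [div_div_eq_mul_div]
  · have h := (tendsto_inv_atTop_zero (𝕜 := ℝ)).const_mul (((2 * j - 1 : ℕ) : ℝ) * n)
    have h' := h.const_sub 1
    rw [mul_zero, sub_zero] at h'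
    refine h'.congr' ?_
    filter_upwards [eventually_ne_atTop 0] with y hy
    simp only [hb]
    field_simp
  · have h := (hlim (j + 1)).div (hlim j) (hpos j).ne'
    rw [Finset.prod_range_succ, mul_div_cancel_left₀ _ (hpos j).ne'] at h
    refine h.congr' ?_
    filter_upwards [eventually_ne_atTop 0] with y hy
    simp only [Pi.div_apply]
    field_simp
    ring
  · filter_upwards [hne j, hne (j + 1)] with y h0 h1
    have hrec : r (j + 1 + 1) y = b (j + 1) y * r (j + 1) y - a (j + 1) * r j y := rfl
    have hj : a (j + 1) ≠ 0 := by
      have := (hpos (j + 1)).ne'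
      rw [Finset.prod_range_succ] at this
      exact right_ne_zero_of_mul this
    have : b (j + 1) y - r (j + 1 + 1) y / r (j + 1) y = a (j + 1) * r j y / r (j + 1) y := by
      rw [hrec]
      field_simp
      ring
    rw [this]
    field_simp
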